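/- Let p, q ∈ ℕ satisfy 3 ≤ p, 3 ≤ q, gcd(p,q) = 1 and q > 2p. Let u : Fin p → ℝ be the constant function q and v : Fin q → ℝ the constant function p, so that T(u,v) is the generalized p×q Birkhoff (central transportation) polytope. Then there exist extreme points a and b of T(u,v) such that every path from a to b in the graph G(T(u,v)) has length at least p + q − 1 (so T(u,v) is Hirsch-sharp, its Hirsch bound being n − d = pq − (p−1)(q−1) = p + q − 1). -/

import Mathlib

open scoped BigOperators

noncomputable section

/-- The classical `p × q` transportation polytope with marginals `u` and `v`. -/
def transportationPolytope {p q : ℕ} (u : Fin p → ℝ) (v : Fin q → ℝ) :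
    Set (Fin p → Fin q → ℝ) :=
  {x | (∀ i j, 0 ≤ x i j) ∧ (∀ i, ∑ j, x i j = u i) ∧ (∀ j, ∑ i, x i j = v j)}

/-- Adjacency in the graph of a convex set `P`: two distinct extreme points whose closed
segment is a face of `P`. -/
def PolyAdj {E : Type*} [AddCommGroup E] [Module ℝ E] (P : Set E) (a b : E) : Prop :=
  a ≠ b ∧ a ∈ Set.extremePoints ℝ P ∧ b ∈ Set.extremePoints ℝ P ∧
    IsExtreme ℝ P (segment ℝ a b)

/-- A path of length `L` in the graph of `P` from `a` to `b`. -/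
def HasPathOfLength {E : Type*} [AddCommGroup E] [Module ℝ E] (P : Set E) (a b : E)
    (L : ℕ) : Prop :=
  ∃ f : ℕ → E, f 0 = a ∧ f L = b ∧ ∀ i < L, PolyAdj P (f i) (f (i + 1))

/-- The positions at which a matrix is nonzero. -/
def entrySupport {p q : ℕ} (x : Fin p → Fin q → ℝ) : Finset (Fin p × Fin q) :=
  Finset.univ.filter fun e => x e.1 e.2 ≠ 0

lemma mem_entrySupport {p q : ℕ} {x : Fin p → Fin q → ℝ} {e : Fin p × Fin q} :
    e ∈ entrySupport x ↔ x e.1 e.2 ≠ 0 := by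
  simp [entrySupport]

lemma isCompact_transportationPolytope {p q : ℕ} (u : Fin p → ℝ) (v : Fin q → ℝ) :
    IsCompact (transportationPolytope u v) := by
  have hK : IsCompact (Set.univ.pi fun i : Fin p => Set.univ.pi fun _ : Fin q =>
      Set.Icc (0 : ℝ) (u i)) :=
    isCompact_univ_pi fun i => isCompact_univ_pi fun _ => isCompact_Icc
  refine hK.of_isClosed_subset ?_ ?_
  · simp only [transportationPolytope, Set.ofPred_and, Set.ofPred_forall]
    refine IsClosed.inter ?_ (IsClosed.inter ?_ ?_)
    · exact isClosed_iInter fun i => isClosed_iInter fun j =>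
        isClosed_le continuous_const (by fun_prop)
    · exact isClosed_iInter fun i => isClosed_eq (by fun_prop) continuous_const
    · exact isClosed_iInter fun j => isClosed_eq (by fun_prop) continuous_const
  · rintro x ⟨h0, hr, -⟩ i - j -
    refine ⟨h0 i j, ?_⟩
    rw [← hr i]
    exact Finset.single_le_sum (f := fun j => x i j) (fun j _ => h0 i j) (Finset.mem_univ j)

/-- The face of a transportation polytope cut out by vanishing outside `S` is extreme. -/
lemma isExtreme_supportedOn {p q : ℕ} (u : Fin p → ℝ) (v : Fin q → ℝ)
    (S : Finset (Fin p × Fin q)) :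
    IsExtreme ℝ (transportationPolytope u v)
      {x ∈ transportationPolytope u v | entrySupport x ⊆ S} := by
  refine ⟨fun x hx => hx.1, ?_⟩
  rintro y hy z hz x ⟨-, hxS⟩ ⟨s, t, hs, ht, -, rfl⟩
  refine ⟨hy, fun e he => hxS ?_⟩
  have hy0 := (hy.1 e.1 e.2).lt_of_ne' (mem_entrySupport.1 he)
  have hz0 := hz.1 e.1 e.2
  rw [mem_entrySupport]
  simp only [Pi.add_apply, Pi.smul_apply, smul_eq_mul]
  positivity

/-- The support of every point of a transportation polytope contains that of a vertex. -/
lemma exists_extremePoint_entrySupport_subset {p q : ℕ} {u : Fin p → ℝ} {v : Fin q → ℝ}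
    {x : Fin p → Fin q → ℝ} (hx : x ∈ transportationPolytope u v) :
    ∃ a ∈ Set.extremePoints ℝ (transportationPolytope u v),
      entrySupport a ⊆ entrySupport x := by
  have hcpt : IsCompact {y ∈ transportationPolytope u v | entrySupport y ⊆ entrySupport x} := by
    refine (isCompact_transportationPolytope u v).inter_right ?_
    have : {y : Fin p → Fin q → ℝ | entrySupport y ⊆ entrySupport x} =
        ⋂ e ∈ (entrySupport x : Set (Fin p × Fin q))ᶜ, {y | y e.1 e.2 = 0} := by
      ext y
      simp only [Set.mem_ofPred_eq, Set.mem_iInter, Set.mem_compl_iff, SetLike.mem_coe]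
      refine forall_congr' fun e => ?_
      rw [mem_entrySupport (x := y)]
      tauto
    change IsClosed {y : Fin p → Fin q → ℝ | entrySupport y ⊆ entrySupport x}
    rw [this]
    exact isClosed_biInter fun e _ => isClosed_eq (by fun_prop) continuous_const
  obtain ⟨a, ha⟩ := hcpt.extremePoints_nonempty ⟨x, hx, subset_rfl⟩
  exact ⟨a, (isExtreme_supportedOn u v _).extremePoints_subset_extremePoints ha, ha.1.2⟩

/-- A potential `f i + g j` vanishing on the support of a point of a central transportation
polytope with coprime sizes is constant. -/
lemma potential_eq_const {p q : ℕ} (hp : 0 < p) (hcop : Nat.Coprime p q)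
    {x : Fin p → Fin q → ℝ}
    (hx : x ∈ transportationPolytope (fun _ : Fin p => (q : ℝ)) (fun _ : Fin q => (p : ℝ)))
    {f : Fin p → ℝ} {g : Fin q → ℝ} (hfg : ∀ e ∈ entrySupport x, f e.1 + g e.2 = 0)
    (i₀ : Fin p) : (∀ i, f i = f i₀) ∧ ∀ j, g j = -f i₀ := by
  obtain ⟨h0, hr, hc⟩ := hx
  set I : Finset (Fin p) := Finset.univ.filter fun i => f i = f i₀ with hI
  set J : Finset (Fin q) := Finset.univ.filter fun j => g j = -f i₀ with hJ
  have hzero : ∀ i j, ¬ (i ∈ I ↔ j ∈ J) → x i j = 0 := by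
    intro i j hij
    by_contra hne
    have := hfg (i, j) (mem_entrySupport.2 hne)
    refine hij ?_
    simp only [hI, hJ, Finset.mem_filter, Finset.mem_univ, true_and] at this ⊢
    constructor <;> intro h <;> linarith
  have h1 : ∑ i ∈ I, ∑ j, x i j = ∑ i ∈ I, ∑ j ∈ J, x i j :=
    Finset.sum_congr rfl fun i hi => (Finset.sum_subset (Finset.subset_univ J)
      fun j _ hj => hzero i j (by tauto)).symm
  have h2 : ∑ j ∈ J, ∑ i, x i j = ∑ j ∈ J, ∑ i ∈ I, x i j :=
    Finset.sum_congr rfl fun j hj => (Finset.sum_subset (Finset.subset_univ I)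
      fun i _ hi => hzero i j (by tauto)).symm
  have h3 : I.card * q = J.card * p := by
    rw [Finset.sum_comm (s := I) (t := J), ← h2] at h1
    simp only [hr, hc, Finset.sum_const, nsmul_eq_mul] at h1
    exact_mod_cast h1
  have hIpos : 0 < I.card := Finset.card_pos.2 ⟨i₀, by simp [hI]⟩
  have hIle : I.card ≤ p := by simpa using Finset.card_le_univ I
  have hIp : I.card = p :=
    le_antisymm hIle (Nat.le_of_dvd hIpos (hcop.dvd_of_dvd_mul_right ⟨J.card, by rw [h3, mul_comm]⟩))
  have hJq : J.card = q := by
    rw [hIp, mul_comm] at h3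
    exact (Nat.eq_of_mul_eq_mul_right hp h3).symm
  have hIu : I = Finset.univ := Finset.eq_univ_of_card I (by simpa using hIp)
  have hJu : J = Finset.univ := Finset.eq_univ_of_card J (by simpa using hJq)
  constructor
  · intro i
    have : i ∈ I := hIu ▸ Finset.mem_univ i
    simpa [hI] using this
  · intro j
    have : j ∈ J := hJu ▸ Finset.mem_univ j
    simpa [hJ] using this

/-- Nondegeneracy: for coprime sizes every point has at least `p + q - 1` nonzero entries. -/
lemma le_card_entrySupport {p q : ℕ} (hp : 0 < p) (hcop : Nat.Coprime p q)
    {x : Fin p → Fin q → ℝ}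
    (hx : x ∈ transportationPolytope (fun _ : Fin p => (q : ℝ)) (fun _ : Fin q => (p : ℝ))) :
    p + q ≤ (entrySupport x).card + 1 := by
  let φ : ((Fin p → ℝ) × (Fin q → ℝ)) →ₗ[ℝ] (entrySupport x → ℝ) × ℝ :=
    { toFun := fun w => (fun e => w.1 e.1.1 + w.2 e.1.2, w.1 ⟨0, hp⟩)
      map_add' := by
        intro w w'
        ext
        · simp; ring
        · simp
      map_smul' := by
        intro c w
        ext
        · simp; ring
        · simp }
  have hφ : Function.Injective φ := by
    rw [injective_iff_map_eq_zero]
    rintro ⟨f, g⟩ h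
    have h1 : ∀ e ∈ entrySupport x, f e.1 + g e.2 = 0 :=
      fun e he => congrFun (congrArg Prod.fst h) ⟨e, he⟩
    have h2 : f ⟨0, hp⟩ = 0 := congrArg Prod.snd h
    obtain ⟨hf, hg⟩ := potential_eq_const hp hcop hx h1 ⟨0, hp⟩
    ext i
    · simp [hf i, h2]
    · simp [hg i, h2]
  simpa using LinearMap.finrank_le_finrank_of_injective hφ

/-- A set of more than `p + q` positions carries a nonzero matrix with vanishing margins which
is zero at a prescribed position. -/
lemma exists_ne_zero_margins_eq_zero {p q : ℕ} {S : Finset (Fin p × Fin q)}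
    (hS : p + q < S.card) (e₀ : Fin p × Fin q) :
    ∃ d : Fin p → Fin q → ℝ, d ≠ 0 ∧ entrySupport d ⊆ S ∧ d e₀.1 e₀.2 = 0 ∧
      (∀ i, ∑ j, d i j = 0) ∧ ∀ j, ∑ i, d i j = 0 := by
  let D : (S → ℝ) → Fin p → Fin q → ℝ :=
    fun w i j => if h : (i, j) ∈ S then w ⟨(i, j), h⟩ else 0
  have hDadd : ∀ w w' i j, D (w + w') i j = D w i j + D w' i j := by
    intro w w' i j; simp only [D]; split_ifs <;> simp
  have hDsmul : ∀ (c : ℝ) w i j, D (c • w) i j = c * D w i j := by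
    intro c w i j; simp only [D]; split_ifs <;> simp
  let φ : (S → ℝ) →ₗ[ℝ] (Fin p → ℝ) × (Fin q → ℝ) :=
    { toFun := fun w => (fun i => ∑ j, D w i j,
        fun j => if j = e₀.2 then D w e₀.1 e₀.2 else ∑ i, D w i j)
      map_add' := by
        intro w w'
        ext
        · simp [hDadd, Finset.sum_add_distrib]
        · simp only [hDadd, Finset.sum_add_distrib, Prod.snd_add, Pi.add_apply]
          split_ifs <;> rfl
      map_smul' := by
        intro c w
        ext
        · simp [hDsmul, Finset.mul_sum]
        · simp only [hDsmul, ← Finset.mul_sum, Prod.smul_snd, Pi.smul_apply, smul_eq_mul,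
            RingHom.id_apply]
          split_ifs <;> rfl }
  obtain ⟨w, hw, hw0⟩ := Submodule.exists_mem_ne_zero_of_ne_bot
    (LinearMap.ker_ne_bot_of_finrank_lt (f := φ) (by simpa using hS))
  have hrow : ∀ i, ∑ j, D w i j = 0 := fun i => congrFun (congrArg Prod.fst hw) i
  have hcol : ∀ j, (if j = e₀.2 then D w e₀.1 e₀.2 else ∑ i, D w i j) = 0 :=
    fun j => congrFun (congrArg Prod.snd hw) j
  refine ⟨D w, ?_, ?_, by simpa using hcol e₀.2, hrow, ?_⟩
  · intro h
    refine hw0 (funext fun e => ?_)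
    have := congrFun (congrFun h e.1.1) e.1.2
    simpa [D] using this
  · intro e he
    by_contra hne
    exact mem_entrySupport.1 he (by simp [D, hne])
  · have hne : ∀ j, j ≠ e₀.2 → ∑ i, D w i j = 0 := fun j hj => by simpa [hj] using hcol j
    intro j
    by_cases hj : j = e₀.2
    · have htot : ∑ j, ∑ i, D w i j = 0 := by
        rw [Finset.sum_comm]
        exact Finset.sum_eq_zero fun i _ => hrow i
      rwa [Finset.sum_eq_single e₀.2 (fun j _ h => hne j h) (by simp), ← hj] at htot
    · exact hne j hj

/-- Perturbing a point of a transportation polytope along a small multiple of a matrix with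
vanishing margins supported where the point is positive stays in the polytope. -/
lemma exists_pos_add_smul_mem {p q : ℕ} {u : Fin p → ℝ} {v : Fin q → ℝ}
    {m d : Fin p → Fin q → ℝ} (hm : m ∈ transportationPolytope u v)
    (hd : entrySupport d ⊆ entrySupport m) (hr : ∀ i, ∑ j, d i j = 0)
    (hc : ∀ j, ∑ i, d i j = 0) :
    ∃ ε : ℝ, 0 < ε ∧ m + ε • d ∈ transportationPolytope u v ∧
      m - ε • d ∈ transportationPolytope u v := by
  have hpos : ∀ e : Fin p × Fin q, ∃ ε : ℝ, 0 < ε ∧ ε * |d e.1 e.2| ≤ m e.1 e.2 := by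
    intro e
    by_cases h : d e.1 e.2 = 0
    · exact ⟨1, one_pos, by simpa [h] using hm.1 e.1 e.2⟩
    · have hme := (hm.1 e.1 e.2).lt_of_ne' (mem_entrySupport.1 (hd (mem_entrySupport.2 h)))
      have := abs_pos.2 h
      exact ⟨m e.1 e.2 / |d e.1 e.2|, by positivity, by field_simp; rfl⟩
  choose ε hε0 hε using hpos
  obtain ⟨δ, hδ0, hδ⟩ : ∃ δ : ℝ, 0 < δ ∧ ∀ e, δ ≤ ε e := by
    rcases isEmpty_or_nonempty (Fin p × Fin q) with h | h
    · exact ⟨1, one_pos, fun e => h.elim e⟩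
    · obtain ⟨e, he⟩ := Finite.exists_min ε
      exact ⟨ε e, hε0 e, he⟩
  have hb : ∀ i j, |δ * d i j| ≤ m i j := by
    intro i j
    rw [abs_mul, abs_of_pos hδ0]
    exact (mul_le_mul_of_nonneg_right (hδ (i, j)) (abs_nonneg _)).trans (hε (i, j))
  refine ⟨δ, hδ0, ⟨fun i j => ?_, fun i => ?_, fun j => ?_⟩,
    fun i j => ?_, fun i => ?_, fun j => ?_⟩
  · have := abs_le.1 (hb i j)
    simp only [Pi.add_apply, Pi.smul_apply, smul_eq_mul]
    linarith
  · simp [Finset.sum_add_distrib, ← Finset.mul_sum, hr, hm.2.1]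
  · simp [Finset.sum_add_distrib, ← Finset.mul_sum, hc, hm.2.2]
  · have := abs_le.1 (hb i j)
    simp only [Pi.sub_apply, Pi.smul_apply, smul_eq_mul]
    linarith
  · simp [Finset.sum_sub_distrib, ← Finset.mul_sum, hr, hm.2.1]
  · simp [Finset.sum_sub_distrib, ← Finset.mul_sum, hc, hm.2.2]

/-- The supports of two adjacent vertices cover at most `p + q` positions. -/
lemma PolyAdj.card_union_entrySupport_le {p q : ℕ} {u : Fin p → ℝ} {v : Fin q → ℝ}
    {a b : Fin p → Fin q → ℝ} (h : PolyAdj (transportationPolytope u v) a b) :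
    (entrySupport a ∪ entrySupport b).card ≤ p + q := by
  obtain ⟨hab, ⟨ha, -⟩, ⟨hb, -⟩, hext⟩ := h
  by_contra! hcard
  obtain ⟨i₀, j₀, hij⟩ : ∃ i j, a i j ≠ b i j := by
    by_contra! h
    exact hab (funext₂ h)
  obtain ⟨d, hd0, hdS, hde, hr, hc⟩ := exists_ne_zero_margins_eq_zero hcard (i₀, j₀)
  set m : Fin p → Fin q → ℝ := (1 / 2 : ℝ) • a + (1 / 2 : ℝ) • b with hm
  have hmseg : m ∈ segment ℝ a b := ⟨1 / 2, 1 / 2, by norm_num, by norm_num, by norm_num, rfl⟩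
  have hsupp : entrySupport a ∪ entrySupport b ⊆ entrySupport m := by
    intro e he
    have h1 := ha.1 e.1 e.2
    have h2 := hb.1 e.1 e.2
    simp only [Finset.mem_union, mem_entrySupport] at he ⊢
    simp only [hm, Pi.add_apply, Pi.smul_apply, smul_eq_mul]
    rcases he with he | he
    · have := h1.lt_of_ne' he
      positivity
    · have := h2.lt_of_ne' he
      positivity
  obtain ⟨ε, hε, hp, hn⟩ := exists_pos_add_smul_mem (hext.1 hmseg) (hdS.trans hsupp) hr hc
  have hmem : m + ε • d ∈ segment ℝ a b := by
    refine hext.2 hp hn hmseg ⟨1 / 2, 1 / 2, by norm_num, by norm_num, by norm_num, ?_⟩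
    module
  rw [segment_eq_image'] at hmem
  obtain ⟨t, -, ht⟩ := hmem
  have hval : ∀ i j, a i j + t * (b i j - a i j) = 1 / 2 * a i j + 1 / 2 * b i j + ε * d i j :=
    fun i j => by simpa [hm] using congrFun (congrFun ht i) j
  have ht2 : t = 1 / 2 := by
    have h1 := hval i₀ j₀
    rw [show d i₀ j₀ = 0 from hde] at h1
    have h2 : (t - 1 / 2) * (b i₀ j₀ - a i₀ j₀) = 0 := by linarith
    rcases mul_eq_zero.1 h2 with h3 | h3
    · linarith
    · exact absurd (by linarith) hij
  refine hd0 (funext₂ fun i j => ?_)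
  have h1 := hval i j
  rw [ht2] at h1
  have h2 : ε * d i j = 0 := by linarith
  exact (mul_eq_zero.1 h2).resolve_left hε.ne'

/-- Vertices with disjoint supports are at distance at least `p + q - 1`. -/
lemma HasPathOfLength.le_of_disjoint_entrySupport {p q : ℕ} (hp : 0 < p)
    (hcop : Nat.Coprime p q) {a b : Fin p → Fin q → ℝ}
    (hb : b ∈ transportationPolytope (fun _ : Fin p => (q : ℝ)) (fun _ : Fin q => (p : ℝ)))
    (hdisj : Disjoint (entrySupport a) (entrySupport b)) {L : ℕ}
    (h : HasPathOfLength
      (transportationPolytope (fun _ : Fin p => (q : ℝ)) (fun _ : Fin q => (p : ℝ))) a b L) :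
    p + q - 1 ≤ L := by
  obtain ⟨f, hf0, hfL, hadj⟩ := h
  have hstep : ∀ k ≤ L, (entrySupport (f k) \ entrySupport a).card ≤ k := by
    intro k
    induction k with
    | zero => simp [hf0]
    | succ k ih =>
      intro hk
      have hk' := hadj k hk
      have h1 := hk'.card_union_entrySupport_le
      have h2 := le_card_entrySupport hp hcop hk'.2.1.1
      have h3 := Finset.card_sdiff_add_card (entrySupport (f (k + 1))) (entrySupport (f k))
      rw [Finset.union_comm] at h3
      have h4 : entrySupport (f (k + 1)) \ entrySupport a ⊆
          (entrySupport (f (k + 1)) \ entrySupport (f k)) ∪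
            (entrySupport (f k) \ entrySupport a) := by
        intro e
        simp only [Finset.mem_union, Finset.mem_sdiff]
        tauto
      have h5 := (Finset.card_le_card h4).trans (Finset.card_union_le _ _)
      have h6 := ih (by omega)
      omega
  have h1 := hstep L le_rfl
  rw [hfL, Finset.sdiff_eq_self_of_disjoint hdisj.symm] at h1
  have := le_card_entrySupport hp hcop hb
  omega

/-- The staircase matrix produced by the northwest corner rule. -/
def staircase (p q : ℕ) (i : Fin p) (j : Fin q) : ℝ :=
  ((Finset.range (p * q)).filter fun n => n / q = i ∧ n / p = j).card

lemma card_filter_div_eq {k l i : ℕ} (hi : i < k) (hl : 0 < l) :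
    ((Finset.range (k * l)).filter fun n => n / l = i).card = l := by
  have : ((Finset.range (k * l)).filter fun n => n / l = i) = Finset.Ico (i * l) (i * l + l) := by
    ext n
    simp only [Finset.mem_filter, Finset.mem_range, Finset.mem_Ico, Nat.div_eq_iff hl]
    have : (i + 1) * l ≤ k * l := Nat.mul_le_mul_right l hi
    rw [add_mul, one_mul] at this
    omega
  simp [this]

lemma staircase_mem {p q : ℕ} (hp : 0 < p) (hq : 0 < q) :
    staircase p q ∈
      transportationPolytope (fun _ : Fin p => (q : ℝ)) (fun _ : Fin q => (p : ℝ)) := by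
  refine ⟨fun i j => Nat.cast_nonneg _, fun i => ?_, fun j => ?_⟩
  · have hcard := card_filter_div_eq i.2 hq
    rw [Finset.card_eq_sum_card_fiberwise (t := Finset.range q) (f := fun n => n / p)] at hcard
    · rw [Finset.sum_range] at hcard
      simp only [Finset.filter_filter] at hcard
      simp only [staircase]
      exact_mod_cast hcard
    · intro n hn
      simp only [Finset.coe_filter, Finset.mem_range, Set.mem_ofPred_eq, Finset.coe_range,
        Set.mem_Iio] at hn ⊢
      exact Nat.div_lt_of_lt_mul hn.1
  · have hcard := card_filter_div_eq j.2 hp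
    rw [mul_comm, Finset.card_eq_sum_card_fiberwise (t := Finset.range p) (f := fun n => n / q)] at hcard
    · rw [Finset.sum_range] at hcard
      simp only [Finset.filter_filter] at hcard
      simp only [staircase, and_comm]
      exact_mod_cast hcard
    · intro n hn
      simp only [Finset.coe_filter, Finset.mem_range, Set.mem_ofPred_eq, Finset.coe_range,
        Set.mem_Iio] at hn ⊢
      exact Nat.div_lt_of_lt_mul (by rw [mul_comm]; exact hn.1)

lemma comp_perm_mem_transportationPolytope {p q : ℕ} {u : Fin p → ℝ} {c : ℝ}
    {x : Fin p → Fin q → ℝ} (hx : x ∈ transportationPolytope u fun _ => c)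
    (σ : Equiv.Perm (Fin q)) : (fun i j => x i (σ j)) ∈ transportationPolytope u fun _ => c :=
  ⟨fun i j => hx.1 i (σ j), fun i => (Equiv.sum_comp σ (x i)).trans (hx.2.1 i),
    fun j => hx.2.2 (σ j)⟩

/-- Two nonzero entries of the staircase in the same row are close to each other. -/
lemma staircase_col_close {p q : ℕ} (hp : 0 < p) (hq : 0 < q) {i : Fin p} {j k : Fin q}
    (hj : staircase p q i j ≠ 0) (hk : staircase p q i k ≠ 0) :
    (k : ℕ) * p + 2 ≤ j * p + q + p := by
  simp only [staircase, Nat.cast_ne_zero, Finset.card_ne_zero, Finset.Nonempty,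
    Finset.mem_filter] at hj hk
  obtain ⟨n, -, hni, hnj⟩ := hj
  obtain ⟨m, -, hmi, hmk⟩ := hk
  rw [Nat.div_eq_iff hp] at hnj hmk
  rw [Nat.div_eq_iff hq] at hni hmi
  omega

lemma disjoint_entrySupport_staircase_shift {p q : ℕ} (hp : 3 ≤ p) (hq2p : 2 * p < q) :
    ∃ σ : Equiv.Perm (Fin q),
      Disjoint (entrySupport (staircase p q))
        (entrySupport fun i j => staircase p q i (σ j)) := by
  have : NeZero q := ⟨by omega⟩
  refine ⟨Equiv.addRight ⟨q / 2, by omega⟩, Finset.disjoint_left.2 ?_⟩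
  rintro ⟨i, j⟩ h1 h2
  rw [mem_entrySupport] at h1 h2
  have h3 := staircase_col_close (by omega) (by omega) h1 h2
  have h4 := staircase_col_close (by omega) (by omega) h2 h1
  simp only [Equiv.coe_addRight, Fin.val_add] at h3 h4
  have hjq := j.2
  obtain ⟨s, hs⟩ : ∃ s, s = q / 2 := ⟨_, rfl⟩
  have hs1 : q ≤ 2 * s + 1 := by omega
  have hs2 : 2 * s ≤ q := by omega
  rw [← hs] at h3 h4
  rcases lt_or_ge ((j : ℕ) + s) q with h | h
  · rw [Nat.mod_eq_of_lt h] at h3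
    have : s * p + 2 ≤ q + p := by linarith
    nlinarith
  · have hmod : ((j : ℕ) + s) % q + q = j + s := by
      rw [Nat.mod_eq_sub_mod h, Nat.mod_eq_of_lt (by omega)]
      omega
    have h5 : (((j : ℕ) + s) % q + q) * p = (j + s) * p := by rw [hmod]
    have : q * p + 2 ≤ s * p + q + p := by linarith
    nlinarith

/-- For coprime `p, q ≥ 3` with `q > 2p`, the generalized `p × q` Birkhoff (central
transportation) polytope is Hirsch-sharp: it has two vertices at graph distance at least
`p + q - 1`. -/
theorem generalizedBirkhoff_hirschSharp
    (p q : ℕ) (hp : 3 ≤ p) (hq : 3 ≤ q) (hcop : Nat.gcd p q = 1) (hq2p : 2 * p < q) :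
    ∃ a ∈ Set.extremePoints ℝ
        (transportationPolytope (fun _ : Fin p => (q : ℝ)) (fun _ : Fin q => (p : ℝ))),
      ∃ b ∈ Set.extremePoints ℝ
          (transportationPolytope (fun _ : Fin p => (q : ℝ)) (fun _ : Fin q => (p : ℝ))),
        ∀ L : ℕ,
          HasPathOfLength
            (transportationPolytope (fun _ : Fin p => (q : ℝ)) (fun _ : Fin q => (p : ℝ)))
            a b L →
          p + q - 1 ≤ L := by
  have hp0 : 0 < p := by omega
  have hx := staircase_mem hp0 (show 0 < q by omega)
  obtain ⟨σ, hσ⟩ := disjoint_entrySupport_staircase_shift hp hq2p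
  obtain ⟨a, ha, hax⟩ := exists_extremePoint_entrySupport_subset hx
  obtain ⟨b, hb, hby⟩ :=
    exists_extremePoint_entrySupport_subset (comp_perm_mem_transportationPolytope hx σ)
  exact ⟨a, ha, b, hb, fun L hL =>
    hL.le_of_disjoint_entrySupport hp0 hcop hb.1 (hσ.mono hax hby)⟩
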